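/- Let Γ be a non-elementary discrete purely hyperbolic subgroup of SL(2,ℝ). Define the critical exponent δ(Γ) to be the infimum of the set of s > 0 for which the Poincaré series Σ_{γ∈Γ} exp(−s · d_ℍ(i, γ·i)) converges, where d_ℍ is the hyperbolic distance on ℍ and i ∈ ℍ. Then the Hausdorff dimension of {x ∈ ℝ : [x:1] is a conical limit point of Γ} (as a subset of ℝ with its standard metric) equals δ(Γ). -/

import Mathlib

open scoped MatrixGroups LinearAlgebra.Projectivization UpperHalfPlane Pointwise
open Matrix

noncomputable section

/-- The topology on `SL(2, ℝ)` as a subspace of the space of `2 × 2` real matrices. -/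
instance : TopologicalSpace SL(2, ℝ) :=
  inferInstanceAs (TopologicalSpace { A : Matrix (Fin 2) (Fin 2) ℝ // A.det = 1 })

/-- The real projective line. -/
abbrev RP1 : Type := ℙ ℝ (Fin 2 → ℝ)

instance : TopologicalSpace RP1 :=
  inferInstanceAs (TopologicalSpace (Quotient (projectivizationSetoid ℝ (Fin 2 → ℝ))))

/-- The action of `SL(2, ℝ)` on the real projective line, via its linear action on `ℝ²`. -/
def sl2Act (g : SL(2, ℝ)) (p : RP1) : RP1 :=
  Projectivization.map (Matrix.SpecialLinearGroup.toLin' g).toLinearMap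
    (Matrix.SpecialLinearGroup.toLin' g).injective p

/-- The point `[x : 1]` of the real projective line. -/
def projPt (x : ℝ) : RP1 :=
  Projectivization.mk ℝ ![x, 1] (by
    intro h
    have := congrFun h 1
    simp at this)

/-- The point `∞ = [1 : 0]` of the real projective line. -/
def projInf : RP1 :=
  Projectivization.mk ℝ ![1, 0] (by
    intro h
    have := congrFun h 0
    simp at this)

/-- The ray in the upper half-plane associated to a point of `ℝP¹`:
`ray [x:1] = {x + i t : 0 < t ≤ 1}` and `ray ∞ = {i t : t ≥ 1}`. -/
def ray (p : RP1) : Set ℍ :=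
  if p.rep 1 = 0 then {z : ℍ | z.re = 0 ∧ 1 ≤ z.im}
  else {z : ℍ | z.re = p.rep 0 / p.rep 1 ∧ z.im ≤ 1}

/-- An element of `SL(2, ℝ)` is hyperbolic if the absolute value of its trace exceeds `2`. -/
def IsHyperbolic (g : SL(2, ℝ)) : Prop :=
  2 < |Matrix.trace (g : Matrix (Fin 2) (Fin 2) ℝ)|

/-- A subgroup of `SL(2, ℝ)` is purely hyperbolic if all of its non-identity elements
are hyperbolic. -/
def PurelyHyperbolic (Γ : Subgroup SL(2, ℝ)) : Prop :=
  ∀ g ∈ Γ, g ≠ 1 → IsHyperbolic g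

/-- A subgroup of `SL(2, ℝ)` is non-elementary if it is not virtually abelian, i.e. it has
no abelian subgroup of finite index. -/
def IsNonElementary (Γ : Subgroup SL(2, ℝ)) : Prop :=
  ¬ ∃ H : Subgroup Γ, H.FiniteIndex ∧ ∀ a ∈ H, ∀ b ∈ H, a * b = b * a

/-- `p ∈ ℝP¹` is a conical limit point of `Γ'` if some compact subset of `ℍ` has infinitely
many `Γ'`-translates meeting the ray ending at `p`. -/
def IsConicalLimitPoint (Γ' : Subgroup SL(2, ℝ)) (p : RP1) : Prop :=
  ∃ K : Set ℍ, IsCompact K ∧ ∃ γ : ℕ → SL(2, ℝ), Function.Injective γ ∧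
    (∀ k, γ k ∈ Γ') ∧ ∀ k, (γ k • K ∩ ray p).Nonempty

/-- `p ∈ ℝP¹` is a uniform conical limit point of `Γ'` if the ray ending at `p` is covered by
the translates of a single compact subset of `ℍ` by an injective sequence in `Γ'`. -/
def IsUniformConicalLimitPoint (Γ' : Subgroup SL(2, ℝ)) (p : RP1) : Prop :=
  ∃ K : Set ℍ, IsCompact K ∧ ∃ γ : ℕ → SL(2, ℝ), Function.Injective γ ∧
    (∀ k, γ k ∈ Γ') ∧ ray p ⊆ ⋃ k, γ k • K

/-- The limit set of a subgroup of `SL(2, ℝ)`: the closure in `ℝP¹` of the set of fixed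
points of hyperbolic elements of the subgroup. -/
def limitSet (Γ' : Subgroup SL(2, ℝ)) : Set RP1 :=
  closure {p : RP1 | ∃ g ∈ Γ', IsHyperbolic g ∧ sl2Act g p = p}

section ConicalLimitSet

open Filter Topology MeasureTheory Set

/-! ### Self-similar-type sets -/

/-- The composition `f (w 0) ∘ ⋯ ∘ f (w (n - 1))` of maps along the first `n` letters of `w`. -/
def prefixComp {ι X : Type*} (f : ι → X → X) (w : ℕ → ι) : ℕ → X → X
  | 0 => id
  | n + 1 => prefixComp f w n ∘ f (w n)

lemma prefixComp_congr {ι X : Type*} (f : ι → X → X) {v w : ℕ → ι} {n : ℕ}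
    (h : ∀ i < n, v i = w i) : prefixComp f v n = prefixComp f w n := by
  induction n with
  | zero => rfl
  | succ n ih =>
    simp only [prefixComp, ih fun i hi => h i (by omega), h n (by omega)]

lemma prefixComp_continuousOn {ι X : Type*} [TopologicalSpace X] {f : ι → X → X} {K : Set X}
    (hmaps : ∀ j, MapsTo (f j) K K) (hcont : ∀ j, ContinuousOn (f j) K) (w : ℕ → ι) (n : ℕ) :
    ContinuousOn (prefixComp f w n) K := by
  induction n with
  | zero => exact continuousOn_id
  | succ n ih => exact ih.comp (hcont _) (hmaps _)

lemma prefixComp_expand {ι X : Type*} [PseudoMetricSpace X] {f : ι → X → X} {K : Set X} {r : ℝ}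
    (hr : 0 ≤ r) (hmaps : ∀ j, MapsTo (f j) K K)
    (hexp : ∀ j, ∀ x ∈ K, ∀ y ∈ K, r * dist x y ≤ dist (f j x) (f j y)) (w : ℕ → ι) (n : ℕ) :
    ∀ x ∈ K, ∀ y ∈ K, r ^ n * dist x y ≤ dist (prefixComp f w n x) (prefixComp f w n y) := by
  induction n with
  | zero => simp [prefixComp]
  | succ n ih =>
    intro x hx y hy
    calc r ^ (n + 1) * dist x y = r ^ n * (r * dist x y) := by ring
      _ ≤ r ^ n * dist (f (w n) x) (f (w n) y) := by gcongr; exact hexp _ x hx y hy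
      _ ≤ _ := ih _ (hmaps _ hx) _ (hmaps _ hy)

/-- The limit set of an iterated function system `f` on `K`. -/
def codedLimitSet {ι X : Type*} (f : ι → X → X) (K : Set X) : Set X :=
  {x | ∃ w : ℕ → ι, ∀ n, x ∈ prefixComp f w n '' K}

lemma exists_mem_prefixComp_image {ι X : Type*} [TopologicalSpace X] [T2Space X]
    {f : ι → X → X} {K : Set X} (hK : IsCompact K) (hne : K.Nonempty)
    (hmaps : ∀ j, MapsTo (f j) K K) (hcont : ∀ j, ContinuousOn (f j) K) (w : ℕ → ι) :
    ∃ x, ∀ n, x ∈ prefixComp f w n '' K := by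
  have hc : ∀ n, IsCompact (prefixComp f w n '' K) := fun n =>
    hK.image_of_continuousOn (prefixComp_continuousOn hmaps hcont w n)
  obtain ⟨x, hx⟩ := IsCompact.nonempty_iInter_of_sequence_nonempty_isCompact_isClosed
    (fun n => prefixComp f w n '' K)
    (fun n => by
      rintro _ ⟨x, hx, rfl⟩
      exact ⟨f (w n) x, hmaps _ hx, rfl⟩)
    (fun n => hne.image _) (hc 0) (fun n => (hc n).isClosed)
  exact ⟨x, fun n => mem_iInter.1 hx n⟩

/-- Finitely many compact sets that are pairwise disjoint are uniformly separated. -/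
lemma exists_pos_separation {ι X : Type*} [Finite ι] [MetricSpace X] {A : ι → Set X}
    (hA : ∀ j, IsCompact (A j)) (hdisj : Pairwise fun i j => Disjoint (A i) (A j)) :
    ∃ η > 0, ∀ i j, i ≠ j → ∀ x ∈ A i, ∀ y ∈ A j, η ≤ dist x y := by
  have h : ∀ p : ι × ι, ∃ η : ℝ, 0 < η ∧ (p.1 ≠ p.2 → ∀ x ∈ A p.1, ∀ y ∈ A p.2, η ≤ dist x y) := by
    rintro ⟨i, j⟩
    by_cases hij : i = j
    · exact ⟨1, one_pos, fun h => absurd hij h⟩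
    · obtain ⟨δ, hδ, h⟩ := (hdisj hij).exists_thickenings (hA i) (hA j).isClosed
      refine ⟨δ, hδ, fun _ x hx y hy => ?_⟩
      by_contra! hlt
      exact disjoint_left.1 h (Metric.mem_thickening_iff.2 ⟨x, hx, by simpa using hδ⟩)
        (Metric.mem_thickening_iff.2 ⟨y, hy, hlt⟩)
  choose η hη h using h
  rcases isEmpty_or_nonempty ι with he | he
  · exact ⟨1, one_pos, fun i => (he.false i).elim⟩
  · obtain ⟨p, hp⟩ := Finite.exists_min η
    exact ⟨η p, hη p, fun i j hij x hx y hy => (hp (i, j)).trans (h (i, j) hij x hx y hy)⟩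

/-- Two points of an iterated function system whose codes first differ at the `n`-th letter. -/
lemma exists_pos_separation_codes {ι X : Type*} [Finite ι] [MetricSpace X] {f : ι → X → X}
    {K : Set X} (hK : IsCompact K) (hmaps : ∀ j, MapsTo (f j) K K)
    (hcont : ∀ j, ContinuousOn (f j) K)
    (hdisj : Pairwise fun i j => Disjoint (f i '' K) (f j '' K)) {r : ℝ} (hr : 0 < r)
    (hexp : ∀ j, ∀ x ∈ K, ∀ y ∈ K, r * dist x y ≤ dist (f j x) (f j y)) :
    ∃ η > 0, ∀ v w : ℕ → ι, ∀ n, (∀ i < n, v i = w i) → v n ≠ w n →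
      ∀ x ∈ prefixComp f v (n + 1) '' K, ∀ y ∈ prefixComp f w (n + 1) '' K,
        η * r ^ n ≤ dist x y := by
  obtain ⟨η, hη, h⟩ := exists_pos_separation (fun j => hK.image_of_continuousOn (hcont j)) hdisj
  refine ⟨η, hη, fun v w n hvw hn => ?_⟩
  rintro _ ⟨x, hx, rfl⟩ _ ⟨y, hy, rfl⟩
  simp only [prefixComp, Function.comp_apply, prefixComp_congr f hvw]
  calc η * r ^ n = r ^ n * η := mul_comm _ _
    _ ≤ r ^ n * dist (f (v n) x) (f (w n) y) := by
      gcongr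
      exact h _ _ hn _ (mem_image_of_mem _ hx) _ (mem_image_of_mem _ hy)
    _ ≤ _ := prefixComp_expand hr.le hmaps hexp w n _ (hmaps _ hx) _ (hmaps _ hy)

/-- Lower bound for the dimension of the limit set of an iterated function system of `M` maps that
are expanding by at least `r` and have disjoint images: it is at least `s` if `1 ≤ M * r ^ s`. -/
theorem le_dimH_codedLimitSet {X : Type*} [MetricSpace X] {M : ℕ} (hM : 1 < M)
    {f : Fin M → X → X} {K : Set X} (hK : IsCompact K) (hne : K.Nonempty)
    (hmaps : ∀ j, MapsTo (f j) K K) (hcont : ∀ j, ContinuousOn (f j) K)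
    (hdisj : Pairwise fun i j => Disjoint (f i '' K) (f j '' K)) {r : ℝ} (hr : 0 < r)
    (hexp : ∀ j, ∀ x ∈ K, ∀ y ∈ K, r * dist x y ≤ dist (f j x) (f j y))
    {s : ℝ} (hs : 0 < s) (hMr : 1 ≤ M * r ^ s) :
    ENNReal.ofReal s ≤ dimH (codedLimitSet f K) := by
  classical
  obtain ⟨η, hη, hsep⟩ := exists_pos_separation_codes hK hmaps hcont hdisj hr hexp
  have : Nonempty (Fin M) := ⟨⟨0, by omega⟩⟩
  choose! code hcode using fun x (hx : x ∈ codedLimitSet f K) => hx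
  have hbound : ∀ v w : ℕ → Fin M, ∀ x y, (∀ n, x ∈ prefixComp f v n '' K) →
      (∀ n, y ∈ prefixComp f w n '' K) →
      |Real.ofDigits v - Real.ofDigits w| ≤ (η ^ s)⁻¹ * dist x y ^ s := by
    intro v w x y hx hy
    by_cases hvw : v = w
    · subst hvw
      simp only [sub_self, abs_zero]
      positivity
    have hex : ∃ n, v n ≠ w n := Function.ne_iff.1 hvw
    have hlt : ∀ i < Nat.find hex, v i = w i := fun i hi => not_not.1 (Nat.find_min hex hi)
    have h1 := hsep v w _ hlt (Nat.find_spec hex) x (hx _) y (hy _)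
    have h2 := Real.abs_ofDigits_sub_ofDigits_le hlt
    set n := Nat.find hex
    have hM0 : (0 : ℝ) < M := by exact_mod_cast (by omega : 0 < M)
    calc _ ≤ ((M : ℝ) ^ n)⁻¹ := h2
      _ ≤ (r ^ s) ^ n := by
        rw [inv_le_iff_one_le_mul₀ (by positivity), ← mul_pow, mul_comm]
        exact one_le_pow₀ hMr
      _ = (η ^ s)⁻¹ * (η * r ^ n) ^ s := by
        rw [Real.mul_rpow hη.le (by positivity), inv_mul_cancel_left₀ (by positivity),
          ← Real.rpow_mul_natCast hr.le, ← Real.rpow_natCast_mul hr.le, mul_comm]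
      _ ≤ _ := by gcongr
  let φ : X → ℝ := fun x => Real.ofDigits (code x)
  have hH : HolderOnWith (Real.toNNReal (η ^ s)⁻¹) (Real.toNNReal s) φ (codedLimitSet f K) := by
    intro x hx y hy
    rw [edist_dist, edist_dist, Real.coe_toNNReal s hs.le,
      ENNReal.ofReal_rpow_of_nonneg dist_nonneg hs.le, ← ENNReal.ofReal_coe_nnreal,
      Real.coe_toNNReal _ (by positivity), ← ENNReal.ofReal_mul (by positivity)]
    exact ENNReal.ofReal_le_ofReal (hbound _ _ x y (hcode x hx) (hcode y hy))
  have himage : Icc (0 : ℝ) 1 ⊆ φ '' codedLimitSet f K := by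
    intro t ht
    obtain ⟨w, -, rfl⟩ := Real.ofDigits_SurjOn hM ht
    obtain ⟨x, hx⟩ := exists_mem_prefixComp_image hK hne hmaps hcont w
    refine ⟨x, ⟨w, hx⟩, ?_⟩
    have := hbound (code x) w x x (hcode x ⟨w, hx⟩) hx
    rw [dist_self, Real.zero_rpow hs.ne', mul_zero] at this
    exact sub_eq_zero.1 (abs_nonpos_iff.1 this)
  have h1 : (1 : ENNReal) ≤ dimH (codedLimitSet f K) / ENNReal.ofReal s := by
    calc (1 : ENNReal) = dimH (Icc (0 : ℝ) 1) := by
          rw [Real.dimH_of_nonempty_interior (by simp)]; simp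
      _ ≤ dimH (φ '' codedLimitSet f K) := dimH_mono himage
      _ ≤ _ := hH.dimH_image_le (Real.toNNReal_pos.2 hs)
  rwa [ENNReal.le_div_iff_mul_le (by simp [hs]) (by simp), one_mul] at h1

/-! ### The upper bound -/

lemma dimH_infinite_closedBall_le {ι X : Type*} [MetricSpace X] (c : ι → X) {a : ι → ℝ}
    (ha : ∀ i, 0 < a i) {s : ℝ} (hs : 0 < s) (hsum : Summable fun i => a i ^ s) :
    dimH {x : X | {i | dist x (c i) ≤ a i}.Infinite} ≤ ENNReal.ofReal s := by
  classical
  borelize X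
  have hcount : Countable ι := by
    have := hsum.countable_support
    rwa [Function.support_eq_univ fun i => (Real.rpow_pos_of_pos (ha i) s).ne',
      countable_univ_iff] at this
  set E := {x : X | {i | dist x (c i) ≤ a i}.Infinite}
  set b : ι → ENNReal := fun i => ENNReal.ofReal (2 * a i) ^ s
  have hb : ∀ i, b i = ENNReal.ofReal (2 ^ s * a i ^ s) := fun i => by
    rw [← Real.mul_rpow zero_le_two (ha i).le, ← ENNReal.ofReal_rpow_of_nonneg
      (by have := ha i; positivity) hs.le]
  have hbsum : ∑' i, b i ≠ ⊤ := by
    simp_rw [hb]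
    exact (hsum.mul_left (2 ^ s)).tsum_ofReal_ne_top
  have htail := ENNReal.tendsto_tsum_compl_atTop_zero hbsum
  let t : ∀ F : Finset ι, {i // i ∉ F} → Set X := fun F i => Metric.closedBall (c i) (a i)
  have hdiam : ∀ F i, Metric.ediam (t F i) ^ s ≤ b i := fun F i => by
    simp only [t, b]
    gcongr
    rw [← Metric.closedEBall_ofReal (ha i).le, ENNReal.ofReal_mul zero_le_two, ENNReal.ofReal_ofNat]
    exact Metric.ediam_closedEBall_le
  have hH : μH[s] E ≤ 0 := by
    refine (Measure.hausdorffMeasure_le_liminf_tsum s E (l := atTop)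
      (fun F : Finset ι => (∑' i : {i // i ∉ F}, b i) ^ s⁻¹) ?_ t ?_ ?_).trans ?_
    · have := htail.ennrpow_const s⁻¹
      rwa [ENNReal.zero_rpow_of_pos (inv_pos.2 hs)] at this
    · refine Eventually.of_forall fun F i => ?_
      rw [ENNReal.le_rpow_inv_iff hs]
      exact (hdiam F i).trans (ENNReal.le_tsum (f := fun i : {i // i ∉ F} => b i) i)
    · refine Eventually.of_forall fun F x hx => ?_
      obtain ⟨i, hi, hiF⟩ := Set.Infinite.exists_notMem_finset hx F
      exact mem_iUnion.2 ⟨⟨i, hiF⟩, hi⟩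
    · rw [← htail.liminf_eq]
      exact liminf_le_liminf (Eventually.of_forall fun F => ENNReal.tsum_le_tsum (hdiam F))
  have := dimH_le_of_hausdorffMeasure_ne_top (s := E) (d := s.toNNReal)
    (by rw [Real.coe_toNNReal s hs.le]; exact (hH.trans_lt (by simp)).ne)
  exact this

lemma ray_projPt (x : ℝ) : ray (projPt x) = {z : ℍ | z.re = x ∧ z.im ≤ 1} := by
  obtain ⟨a, ha⟩ := Projectivization.exists_smul_eq_mk_rep ℝ ![x, 1]
    (by intro h; have := congrFun h 1; simp at this)
  have h0 : (projPt x).rep 0 = a * x := by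
    rw [projPt, ← ha]; simp [Units.smul_def]
  have h1 : (projPt x).rep 1 = a := by
    rw [projPt, ← ha]; simp [Units.smul_def]
  simp [ray, h0, h1]

/-- A discrete group has finite orbit counts. -/
lemma finite_dist_smul_I_le (Γ : Subgroup SL(2, ℝ)) (hdisc : DiscreteTopology Γ) (R : ℝ) :
    {γ : Γ | dist UpperHalfPlane.I ((γ : SL(2, ℝ)) • UpperHalfPlane.I) ≤ R}.Finite := by
  have hd : @DiscreteTopology Γ
    (@instTopologicalSpaceSubtype _ _ Matrix.SpecialLinearGroup.instTopologicalSpace) := hdisc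
  have hclosed : @IsClosed _ Matrix.SpecialLinearGroup.instTopologicalSpace (Γ : Set SL(2, ℝ)) :=
    @Subgroup.isClosed_of_discrete _ _ Matrix.SpecialLinearGroup.instTopologicalSpace _ _ _ hd
  have hc := UpperHalfPlane.isProperMap_smul_I.isCompact_preimage
    (isCompact_closedBall UpperHalfPlane.I R)
  have hfin := @IsCompact.finite _ Matrix.SpecialLinearGroup.instTopologicalSpace _
    (hc.inter_right hclosed)
    ((isDiscrete_iff_discreteTopology.2 hd).mono inter_subset_right)
  refine Finite.of_finite_image (f := ((↑) : Γ → SL(2, ℝ))) (hfin.subset ?_)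
    Subtype.val_injective.injOn
  rintro _ ⟨γ, hγ, rfl⟩
  exact ⟨by simpa [dist_comm] using hγ, γ.2⟩

/-- A bound for the Euclidean position of points near a vertical ray. -/
lemma abs_re_sub_le_of_dist_le {z w : ℍ} {R : ℝ} (hw : w.im ≤ 1) (h : dist z w ≤ R) :
    |w.re - z.re| ≤ (Real.exp R *
      (((|w.re| + Real.exp R) ^ 2 + Real.exp R ^ 2 + 1))) * Real.exp (-dist UpperHalfPlane.I z) := by
  have hzim : z.im ≤ Real.exp R := by
    calc z.im ≤ w.im * Real.exp (dist z w) := UpperHalfPlane.im_le_im_mul_exp_dist z w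
      _ ≤ 1 * Real.exp R := by gcongr
      _ = _ := one_mul _
  have h1 : |w.re - z.re| ≤ z.im * Real.exp R := by
    calc |w.re - z.re| ≤ dist (w : ℂ) z := by
          rw [Complex.dist_eq]; simpa using Complex.abs_re_le_norm ((w : ℂ) - z)
      _ ≤ z.im * (Real.exp (dist w z) - 1) := UpperHalfPlane.dist_coe_le w z
      _ ≤ z.im * Real.exp R := by
        have := Real.exp_le_exp.2 h
        rw [dist_comm] at this
        have := z.im_pos
        gcongr
        linarith
  have h1' : |w.re - z.re| ≤ Real.exp R := by
    have h2 : dist (z : ℂ) w ≤ w.im * (Real.exp (dist z w) - 1) := UpperHalfPlane.dist_coe_le z w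
    have h3 : |z.re - w.re| ≤ dist (z : ℂ) w := by
      rw [Complex.dist_eq]; simpa using Complex.abs_re_le_norm ((z : ℂ) - w)
    have := Real.exp_le_exp.2 h
    have := w.im_pos
    rw [abs_sub_comm]
    nlinarith [Real.exp_pos (dist z w), Real.one_le_exp (dist_nonneg (x := z) (y := w))]
  have hzre : |z.re| ≤ |w.re| + Real.exp R := by
    have := abs_sub_abs_le_abs_sub z.re w.re
    rw [abs_sub_comm] at this
    linarith
  set A := (|w.re| + Real.exp R) ^ 2 + Real.exp R ^ 2 + 1
  have h2 : z.im ≤ A * Real.exp (-dist UpperHalfPlane.I z) := by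
    have hc := UpperHalfPlane.cosh_dist' UpperHalfPlane.I z
    have hzp := z.im_pos
    rw [eq_div_iff (by simp; positivity)] at hc
    simp only [UpperHalfPlane.I_re, UpperHalfPlane.I_im] at hc
    rw [Real.cosh_eq] at hc
    have hA : z.re ^ 2 + 1 + z.im ^ 2 ≤ A := by
      have : z.re ^ 2 ≤ (|w.re| + Real.exp R) ^ 2 := by
        rw [← sq_abs]; gcongr
      have : z.im ^ 2 ≤ Real.exp R ^ 2 := by gcongr
      simp only [A]
      linarith
    have hE := Real.exp_pos (dist UpperHalfPlane.I z)
    have hE' := Real.exp_pos (-dist UpperHalfPlane.I z)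
    rw [Real.exp_neg, ← div_eq_mul_inv, le_div_iff₀ hE]
    nlinarith
  calc _ ≤ z.im * Real.exp R := h1
    _ ≤ (A * Real.exp (-dist UpperHalfPlane.I z)) * Real.exp R := by gcongr
    _ = _ := by ring

lemma exists_infinite_of_isConicalLimitPoint {Γ : Subgroup SL(2, ℝ)} {x : ℝ}
    (hx : IsConicalLimitPoint Γ (projPt x)) :
    ∃ C : ℝ, {γ : Γ | dist x ((γ : SL(2, ℝ)) • UpperHalfPlane.I).re ≤
      C * Real.exp (-dist UpperHalfPlane.I ((γ : SL(2, ℝ)) • UpperHalfPlane.I))}.Infinite := by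
  obtain ⟨K, hK, g, hg, hmem, hmeet⟩ := hx
  obtain ⟨R, hR⟩ := hK.isBounded.subset_closedBall UpperHalfPlane.I
  refine ⟨Real.exp R * ((|x| + Real.exp R) ^ 2 + Real.exp R ^ 2 + 1),
    infinite_of_injective_forall_mem (f := fun k => (⟨g k, hmem k⟩ : Γ))
    (fun i j hij => hg (congrArg Subtype.val hij)) fun k => ?_⟩
  obtain ⟨w, hwK, hw⟩ := hmeet k
  rw [ray_projPt] at hw
  obtain ⟨v, hv, rfl⟩ := mem_smul_set.1 hwK
  have h := abs_re_sub_le_of_dist_le (z := g k • UpperHalfPlane.I) (R := R) hw.2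
    (by rw [dist_smul, dist_comm]; exact hR hv)
  rwa [hw.1] at h

theorem dimH_conical_le {Γ : Subgroup SL(2, ℝ)} {s : ℝ} (hs : 0 < s)
    (hsum : Summable fun γ : Γ => Real.exp
      (-s * dist UpperHalfPlane.I ((γ : SL(2, ℝ)) • UpperHalfPlane.I))) :
    dimH {x : ℝ | IsConicalLimitPoint Γ (projPt x)} ≤ ENNReal.ofReal s := by
  have hsub : {x : ℝ | IsConicalLimitPoint Γ (projPt x)} ⊆
      ⋃ m : ℕ, {x : ℝ | {γ : Γ | dist x ((γ : SL(2, ℝ)) • UpperHalfPlane.I).re ≤ (m + 1) *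
        Real.exp (-dist UpperHalfPlane.I ((γ : SL(2, ℝ)) • UpperHalfPlane.I))}.Infinite} := by
    intro x hx
    obtain ⟨C, hC⟩ := exists_infinite_of_isConicalLimitPoint hx
    obtain ⟨m, hm⟩ := exists_nat_ge C
    refine mem_iUnion.2 ⟨m, hC.mono fun γ hγ => le_trans hγ.out ?_⟩
    gcongr
    linarith
  refine (dimH_mono hsub).trans ?_
  rw [dimH_iUnion]
  refine iSup_le fun m => dimH_infinite_closedBall_le _ (fun γ => by positivity) hs ?_
  refine (hsum.mul_left (((m : ℝ) + 1) ^ s)).congr fun γ => ?_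
  rw [Real.mul_rpow (by positivity) (by positivity), ← Real.exp_mul]
  ring_nf

/-! ### Möbius action on the real line -/

/-- The denominator `c x + d` of the Möbius action of a matrix at a real point. -/
def realDenom (g : Matrix (Fin 2) (Fin 2) ℝ) (x : ℝ) : ℝ := g 1 0 * x + g 1 1

/-- The Möbius action `x ↦ (a x + b) / (c x + d)` of a matrix on the real line. -/
def realMobius (g : Matrix (Fin 2) (Fin 2) ℝ) (x : ℝ) : ℝ :=
  (g 0 0 * x + g 0 1) / realDenom g x

lemma realDenom_mul (g h : Matrix (Fin 2) (Fin 2) ℝ) {x : ℝ} (hx : realDenom h x ≠ 0) :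
    realDenom (g * h) x = realDenom g (realMobius h x) * realDenom h x := by
  simp only [realMobius]
  unfold realDenom at *
  simp only [Matrix.mul_apply, Fin.sum_univ_two]
  field_simp
  ring

lemma realMobius_mul (g h : Matrix (Fin 2) (Fin 2) ℝ) {x : ℝ} (hx : realDenom h x ≠ 0) :
    realMobius (g * h) x = realMobius g (realMobius h x) := by
  rw [realMobius, realDenom_mul g h hx, mul_comm (realDenom g _), ← div_div, realMobius.eq_1 g]
  congr 1
  simp only [realMobius, Matrix.mul_apply, Fin.sum_univ_two]
  field_simp
  unfold realDenom
  ring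

lemma realMobius_sub (g : SL(2, ℝ)) {x y : ℝ} (hx : realDenom g x ≠ 0) (hy : realDenom g y ≠ 0) :
    realMobius g x - realMobius g y = (x - y) / (realDenom g x * realDenom g y) := by
  have hdet : g 0 0 * g 1 1 - g 0 1 * g 1 0 = 1 := by
    rw [← Matrix.det_fin_two]; exact g.det_coe
  rw [realMobius, realMobius, div_sub_div _ _ hx hy]
  congr 1
  unfold realDenom
  linear_combination (x - y) * hdet

lemma continuousOn_realMobius {g : Matrix (Fin 2) (Fin 2) ℝ} {K : Set ℝ}
    (h : ∀ x ∈ K, realDenom g x ≠ 0) : ContinuousOn (realMobius g) K := by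
  refine ContinuousOn.div (by fun_prop) ?_ h
  unfold realDenom
  fun_prop

/-- If the pole of `g` is outside a ball then `c / (c x + d)` is bounded on it. -/
lemma abs_mul_le_abs_realDenom {g : Matrix (Fin 2) (Fin 2) ℝ} {y δ : ℝ}
    (h : ∀ x ∈ Metric.closedBall y δ, realDenom g x ≠ 0) :
    |g 1 0| * δ ≤ |realDenom g y| := by
  by_contra! hlt
  have hc : g 1 0 ≠ 0 := by
    intro h0
    simp only [h0, abs_zero, zero_mul] at hlt
    exact absurd hlt (abs_nonneg _).not_gt
  refine h (y - realDenom g y / g 1 0) ?_ ?_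
  · rw [Metric.mem_closedBall, Real.dist_eq, sub_sub_cancel_left, abs_neg, abs_div,
      div_le_iff₀ (abs_pos.2 hc), mul_comm]
    exact hlt.le
  · unfold realDenom
    field_simp
    ring

/-- The point of height `1 / (c y + d) ^ 2` above the image of `y` under `g`. -/
def shadowPoint (g : SL(2, ℝ)) (y : ℝ) (h : realDenom g y ≠ 0) : ℍ :=
  ⟨⟨realMobius g y, 1 / realDenom g y ^ 2⟩, by simp only; positivity⟩

/-- The shadow point over `g y` is at bounded distance from the orbit point `g i`. -/
lemma dist_smul_I_shadowPoint_le (g : SL(2, ℝ)) (y : ℝ) (h : realDenom g y ≠ 0) :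
    dist (g • UpperHalfPlane.I) (shadowPoint g y h) ≤
      Real.log (((|y| + 1) ^ 2 + 2) * (1 + (g 1 0 / realDenom g y) ^ 2)) := by
  set D := realDenom g y with hD
  set m := g 1 0 / D with hm
  have hm0 : 0 < 1 + m ^ 2 := by positivity
  let k : ℍ := ⟨⟨y - m / (1 + m ^ 2), 1 / (1 + m ^ 2)⟩, by simp only; positivity⟩
  have hk : g • k = shadowPoint g y h := by
    have hdet : g 0 0 * g 1 1 - g 0 1 * g 1 0 = 1 := by
      rw [← Matrix.det_fin_two]; exact g.det_coe
    ext
    rw [UpperHalfPlane.coe_specialLinearGroup_apply]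
    have hden : (algebraMap ℝ ℝ (g 1 0) : ℂ) * (k : ℂ) + (algebraMap ℝ ℝ (g 1 1) : ℂ) ≠ 0 := by
      intro h0
      have him := congrArg Complex.im h0
      have hre := congrArg Complex.re h0
      have hkim := k.im_pos
      simp only [Algebra.algebraMap_self, RingHom.id_apply, Complex.add_im, Complex.mul_im,
        Complex.ofReal_re, Complex.ofReal_im, Complex.zero_im, zero_mul, add_zero,
        Complex.add_re, Complex.mul_re, Complex.zero_re, sub_zero, mul_eq_zero] at him hre
      rcases him with hc | hc
      · rw [hc] at hre
        apply h
        rw [hD]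
        unfold realDenom
        rw [hc]
        linarith
      · exact hkim.ne' hc
    rw [div_eq_iff hden]
    have hD0 : D ≠ 0 := h
    set X := realMobius g y with hX
    have hc : g 1 0 = m * D := by rw [hm]; field_simp
    have hd : g 1 1 = D - m * D * y := by rw [← hc, hD]; unfold realDenom; ring
    have hXD : X * D = g 0 0 * y + g 0 1 := by rw [hX, realMobius, ← hD]; field_simp
    have ha : g 0 0 = m * D * X + 1 / D := by
      rw [hc, hd] at hdet
      field_simp
      linear_combination hdet - m * D * hXD
    have hb : g 0 1 = X * D - (m * D * X + 1 / D) * y := by rw [← ha]; linarith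
    have hkre : (k : ℂ).re = y - m / (1 + m ^ 2) := rfl
    have hkim : (k : ℂ).im = 1 / (1 + m ^ 2) := rfl
    have hpre : (shadowPoint g y h : ℂ).re = X := rfl
    have hpim : (shadowPoint g y h : ℂ).im = 1 / D ^ 2 := rfl
    apply Complex.ext
    · simp only [Algebra.algebraMap_self, RingHom.id_apply, Complex.add_re, Complex.mul_re,
        Complex.add_im, Complex.mul_im, Complex.ofReal_re, Complex.ofReal_im, hkre, hkim, hpre,
        hpim, ha, hb, hc, hd]
      field_simp
      ring
    · simp only [Algebra.algebraMap_self, RingHom.id_apply, Complex.add_re, Complex.mul_re,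
        Complex.add_im, Complex.mul_im, Complex.ofReal_re, Complex.ofReal_im, hkre, hkim, hpre,
        hpim, ha, hb, hc, hd]
      field_simp
      ring
  rw [← hk, dist_smul, dist_comm, Real.le_log_iff_exp_le (by positivity)]
  have hc := UpperHalfPlane.cosh_dist' k UpperHalfPlane.I
  have hkim : k.im = 1 / (1 + m ^ 2) := rfl
  have hkre : k.re = y - m / (1 + m ^ 2) := rfl
  have h1 : Real.exp (dist k UpperHalfPlane.I) ≤ 2 * Real.cosh (dist k UpperHalfPlane.I) := by
    rw [Real.cosh_eq]
    linarith [Real.exp_pos (-dist k UpperHalfPlane.I)]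
  refine h1.trans ?_
  rw [hc]
  have hre : |k.re| ≤ |y| + 1 := by
    rw [hkre]
    have : |m / (1 + m ^ 2)| ≤ 1 := by
      rw [abs_div, abs_of_pos hm0, div_le_one hm0]
      nlinarith [sq_nonneg (|m| - 1), sq_abs m]
    calc _ ≤ |y| + |m / (1 + m ^ 2)| := abs_sub _ _
      _ ≤ _ := by linarith
  have hre2 : k.re ^ 2 ≤ (|y| + 1) ^ 2 := by
    rw [← sq_abs]; gcongr
  have him : k.im ≤ 1 := by
    rw [hkim, div_le_one hm0]
    nlinarith [sq_nonneg m]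
  have him2 : k.im ^ 2 ≤ 1 := by
    have := k.im_pos
    nlinarith
  have : 2 * ((k.re ^ 2 + k.im ^ 2 + 1) / (2 * k.im)) = (k.re ^ 2 + k.im ^ 2 + 1) * (1 + m ^ 2) := by
    rw [hkim]
    field_simp
  simp only [UpperHalfPlane.I_re, UpperHalfPlane.I_im, sub_zero, one_pow, mul_one]
  rw [this]
  gcongr ?_ * _
  linarith

/-! ### Systems of contracting elements -/

/-- `g` contracts the ball of radius `ρ` about `x₀` into the concentric ball of half the radius. -/
def ContractsInto (x₀ ρ : ℝ) (g : Matrix (Fin 2) (Fin 2) ℝ) : Prop :=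
  ∀ x ∈ Metric.closedBall x₀ ρ,
    2 ≤ |realDenom g x| ∧ realMobius g x ∈ Metric.closedBall x₀ (ρ / 2)

namespace ContractsInto

variable {x₀ ρ : ℝ}

lemma realDenom_ne_zero {g : Matrix (Fin 2) (Fin 2) ℝ} (hg : ContractsInto x₀ ρ g) {x : ℝ}
    (hx : x ∈ Metric.closedBall x₀ ρ) : realDenom g x ≠ 0 :=
  abs_pos.1 (two_pos.trans_le (hg x hx).1)

lemma mapsTo {g : Matrix (Fin 2) (Fin 2) ℝ} (hρ : 0 < ρ) (hg : ContractsInto x₀ ρ g) :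
    MapsTo (realMobius g) (Metric.closedBall x₀ ρ) (Metric.closedBall x₀ ρ) := fun x hx =>
  Metric.closedBall_subset_closedBall (by linarith) (hg x hx).2

lemma mul {g h : Matrix (Fin 2) (Fin 2) ℝ} (hρ : 0 < ρ) (hg : ContractsInto x₀ ρ g)
    (hh : ContractsInto x₀ ρ h) : ContractsInto x₀ ρ (g * h) := by
  intro x hx
  have h1 := hg _ (hh.mapsTo hρ hx)
  rw [realDenom_mul _ _ (hh.realDenom_ne_zero hx), realMobius_mul _ _ (hh.realDenom_ne_zero hx),
    abs_mul]
  refine ⟨?_, h1.2⟩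
  nlinarith [h1.1, (hh x hx).1]

lemma ne_one (hρ : 0 < ρ) {g : SL(2, ℝ)} (hg : ContractsInto x₀ ρ g) : g ≠ 1 := by
  rintro rfl
  have := (hg x₀ (Metric.mem_closedBall_self hρ.le)).1
  norm_num [realDenom] at this

end ContractsInto

/-- The product of the first `n` letters of a word in `SL(2, ℝ)`. -/
def prefixProd (g : ℕ → SL(2, ℝ)) : ℕ → SL(2, ℝ)
  | 0 => 1
  | n + 1 => prefixProd g n * g n

lemma prefixProd_mem {Γ : Subgroup SL(2, ℝ)} {g : ℕ → SL(2, ℝ)} (hg : ∀ n, g n ∈ Γ) (n : ℕ) :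
    prefixProd g n ∈ Γ := by
  induction n with
  | zero => exact Γ.one_mem
  | succ n ih => exact Γ.mul_mem ih (hg n)

lemma exists_contractsInto_prefixProd {x₀ ρ : ℝ} (hρ : 0 < ρ) {g : ℕ → SL(2, ℝ)}
    (hg : ∀ n, ContractsInto x₀ ρ (g n)) (n k : ℕ) :
    ∃ h : SL(2, ℝ), ContractsInto x₀ ρ h ∧ prefixProd g (n + k + 1) = prefixProd g n * h := by
  induction k with
  | zero => exact ⟨g n, hg n, rfl⟩
  | succ k ih =>
    obtain ⟨h, hh, heq⟩ := ih
    refine ⟨h * g (n + k + 1), by simpa using hh.mul hρ (hg _), ?_⟩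
    rw [← mul_assoc, ← heq]
    rfl

lemma prefixProd_injective {x₀ ρ : ℝ} (hρ : 0 < ρ) {g : ℕ → SL(2, ℝ)}
    (hg : ∀ n, ContractsInto x₀ ρ (g n)) : Function.Injective (prefixProd g) := by
  refine Function.Injective.of_lt_imp_ne fun n m hnm heq => ?_
  obtain ⟨k, rfl⟩ := Nat.exists_eq_add_of_lt hnm
  obtain ⟨h, hh, heq'⟩ := exists_contractsInto_prefixProd hρ hg n k
  exact hh.ne_one hρ (left_eq_mul.1 (heq.trans heq'))

lemma contractsInto_prefixProd_succ {x₀ ρ : ℝ} (hρ : 0 < ρ) {g : ℕ → SL(2, ℝ)}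
    (hg : ∀ n, ContractsInto x₀ ρ (g n)) (n : ℕ) : ContractsInto x₀ ρ (prefixProd g (n + 1)) := by
  obtain ⟨h, hh, heq⟩ := exists_contractsInto_prefixProd hρ hg 0 n
  rw [zero_add, prefixProd, one_mul] at heq
  rwa [heq]

lemma prefixComp_realMobius {ι : Type*} {x₀ ρ : ℝ} (hρ : 0 < ρ) {g : ι → SL(2, ℝ)}
    (hg : ∀ j, ContractsInto x₀ ρ (g j)) (w : ℕ → ι) (n : ℕ) :
    EqOn (prefixComp (fun j => realMobius (g j)) w n)
      (realMobius (prefixProd (fun k => g (w k)) n)) (Metric.closedBall x₀ ρ) := by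
  induction n with
  | zero => intro x _; simp [prefixComp, prefixProd, realMobius, realDenom]
  | succ n ih =>
    intro x hx
    rw [prefixProd, Matrix.SpecialLinearGroup.coe_mul,
      realMobius_mul _ _ ((hg _).realDenom_ne_zero hx), ← ih ((hg _).mapsTo hρ hx)]
    rfl

/-- The limit set of a system of contracting elements of `Γ` consists of conical limit points. -/
theorem codedLimitSet_subset_conical {ι : Type*} {Γ : Subgroup SL(2, ℝ)} {x₀ ρ : ℝ} (hρ : 0 < ρ)
    {g : ι → SL(2, ℝ)} (hgΓ : ∀ j, g j ∈ Γ) (hg : ∀ j, ContractsInto x₀ ρ (g j)) :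
    codedLimitSet (fun j => realMobius (g j)) (Metric.closedBall x₀ ρ) ⊆
      {x : ℝ | IsConicalLimitPoint Γ (projPt x)} := by
  rintro x ⟨w, hw⟩
  set γ := prefixProd fun k => g (w k) with hγ
  set R := Real.log (((|x₀| + ρ + 1) ^ 2 + 2) * (1 + (2 / ρ) ^ 2))
  refine ⟨Metric.closedBall UpperHalfPlane.I R, isCompact_closedBall _ _, fun n => γ (n + 1),
    (prefixProd_injective hρ fun n => hg (w n)).comp (add_left_injective 1),
    fun n => prefixProd_mem (fun k => hgΓ _) _, fun n => ?_⟩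
  have hc : ContractsInto x₀ ρ (γ (n + 1)) := contractsInto_prefixProd_succ hρ (fun n => hg (w n)) n
  obtain ⟨y', hy', hxy⟩ := hw (n + 2)
  rw [prefixComp, Function.comp_apply] at hxy
  obtain ⟨-, hy⟩ := hg (w (n + 1)) y' hy'
  set y := realMobius (g (w (n + 1))) y'
  have hyρ : y ∈ Metric.closedBall x₀ ρ :=
    Metric.closedBall_subset_closedBall (by linarith) hy
  rw [prefixComp_realMobius hρ hg w (n + 1) hyρ] at hxy
  have h0 := hc.realDenom_ne_zero hyρ
  have h2 := (hc y hyρ).1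
  have hpole : |(γ (n + 1)) 1 0| * (ρ / 2) ≤ |realDenom (γ (n + 1)) y| := by
    refine abs_mul_le_abs_realDenom fun z hz => hc.realDenom_ne_zero ?_
    refine Metric.closedBall_subset_closedBall' ?_ hz
    linarith [Metric.mem_closedBall.1 hy]
  have hratio : (γ (n + 1) 1 0 / realDenom (γ (n + 1)) y) ^ 2 ≤ (2 / ρ) ^ 2 := by
    rw [← sq_abs, abs_div]
    gcongr ?_ ^ 2
    rw [div_le_div_iff₀ (abs_pos.2 h0) hρ]
    linarith
  have hyabs : |y| ≤ |x₀| + ρ := by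
    have h3 := Metric.mem_closedBall.1 hyρ
    rw [Real.dist_eq] at h3
    linarith [abs_sub_abs_le_abs_sub y x₀]
  have hd := (dist_smul_I_shadowPoint_le (γ (n + 1)) y h0).trans
    (Real.log_le_log (by positivity) (show _ ≤ ((|x₀| + ρ + 1) ^ 2 + 2) * (1 + (2 / ρ) ^ 2) by
      gcongr))
  refine ⟨shadowPoint _ y h0, ?_, ?_⟩
  · rw [mem_smul_set_iff_inv_smul_mem, Metric.mem_closedBall, dist_comm,
      ← dist_smul (γ (n + 1)), smul_inv_smul]
    exact hd
  · rw [ray_projPt]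
    refine ⟨hxy, ?_⟩
    change 1 / realDenom (γ (n + 1)) y ^ 2 ≤ 1
    rw [← sq_abs, div_le_one (by positivity)]
    nlinarith

/-! ### Position of the concentration of the orbit -/

/-- A non-elementary purely hyperbolic group does not fix a direction of the plane. -/
lemma exists_mulVec_not_parallel {Γ : Subgroup SL(2, ℝ)} (hPH : PurelyHyperbolic Γ)
    (hNE : IsNonElementary Γ) {w : Fin 2 → ℝ} (hw : w ≠ 0) :
    ∃ h ∈ Γ, ∀ c : ℝ, (h : Matrix (Fin 2) (Fin 2) ℝ) *ᵥ w ≠ c • w := by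
  by_contra! hfix
  refine hNE ⟨⊤, inferInstance, fun a _ b _ => ?_⟩
  have hcomm : ∀ a ∈ Γ, ∀ b ∈ Γ, a * b = b * a := by
    intro a ha b hb
    by_contra hne
    have hk : (b * a)⁻¹ * (a * b) ∈ Γ := Γ.mul_mem (Γ.inv_mem (Γ.mul_mem hb ha)) (Γ.mul_mem ha hb)
    have hk1 : (b * a)⁻¹ * (a * b) ≠ 1 := fun h => hne (inv_mul_eq_one.1 h).symm
    obtain ⟨c, hc⟩ := hfix a ha
    obtain ⟨d, hd⟩ := hfix b hb
    have hab : ((a * b : SL(2, ℝ)) : Matrix (Fin 2) (Fin 2) ℝ) *ᵥ w = (c * d) • w := by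
      rw [Matrix.SpecialLinearGroup.coe_mul, ← Matrix.mulVec_mulVec, hd, Matrix.mulVec_smul, hc,
        smul_smul, mul_comm]
    have hba : ((b * a : SL(2, ℝ)) : Matrix (Fin 2) (Fin 2) ℝ) *ᵥ w = (c * d) • w := by
      rw [Matrix.SpecialLinearGroup.coe_mul, ← Matrix.mulVec_mulVec, hc, Matrix.mulVec_smul, hd,
        smul_smul]
    have hkw : (((b * a)⁻¹ * (a * b) : SL(2, ℝ)) : Matrix (Fin 2) (Fin 2) ℝ) *ᵥ w = w := by
      rw [Matrix.SpecialLinearGroup.coe_mul, ← Matrix.mulVec_mulVec, hab, ← hba,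
        Matrix.mulVec_mulVec, ← Matrix.SpecialLinearGroup.coe_mul, inv_mul_cancel,
        Matrix.SpecialLinearGroup.coe_one, Matrix.one_mulVec]
    have hhyp := hPH _ hk hk1
    set k := (b * a)⁻¹ * (a * b)
    have hdet : (k : Matrix (Fin 2) (Fin 2) ℝ).det = 1 := k.det_coe
    have hker : ((k : Matrix (Fin 2) (Fin 2) ℝ) - 1).det = 0 :=
      Matrix.exists_mulVec_eq_zero_iff.1 ⟨w, hw, by
        rw [Matrix.sub_mulVec, hkw, Matrix.one_mulVec, sub_self]⟩
    rw [Matrix.det_fin_two] at hdet hker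
    simp only [Matrix.sub_apply, Matrix.one_apply_eq, ne_eq, zero_ne_one, not_false_eq_true,
      Matrix.one_apply_ne, one_ne_zero, sub_zero] at hker
    have htr : Matrix.trace (k : Matrix (Fin 2) (Fin 2) ℝ) = 2 := by
      rw [Matrix.trace_fin_two]
      linarith
    rw [_root_.IsHyperbolic, htr] at hhyp
    norm_num at hhyp
  exact Subtype.ext (hcomm a a.2 b b.2)

/-- A non-zero singular `2 × 2` matrix has rank one. -/
lemma exists_eq_vecMulVec {A : Matrix (Fin 2) (Fin 2) ℝ} (hA : A ≠ 0) (hdet : A.det = 0) :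
    ∃ u v : Fin 2 → ℝ, u ≠ 0 ∧ v ≠ 0 ∧ A = Matrix.vecMulVec u v := by
  rw [Matrix.det_fin_two] at hdet
  suffices h : ∃ u v : Fin 2 → ℝ, A = Matrix.vecMulVec u v by
    obtain ⟨u, v, rfl⟩ := h
    refine ⟨u, v, ?_, ?_, rfl⟩
    · rintro rfl; simp at hA
    · rintro rfl; simp at hA
  by_cases h0 : A 0 = 0
  · refine ⟨![0, 1], A 1, ?_⟩
    ext i j
    fin_cases i
    · simpa [Matrix.vecMulVec_apply] using congrFun h0 j
    · simp [Matrix.vecMulVec_apply]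
  · by_cases h00 : A 0 0 = 0
    · have h01 : A 0 1 ≠ 0 := by
        intro h01
        apply h0
        ext j
        fin_cases j <;> assumption
      refine ⟨![1, A 1 1 / A 0 1], A 0, ?_⟩
      ext i j
      fin_cases i
      · simp [Matrix.vecMulVec_apply]
      · fin_cases j
        · simp [Matrix.vecMulVec_apply, h00]
          rw [h00] at hdet
          simpa [h01] using hdet
        · simp [Matrix.vecMulVec_apply, h01]
    · refine ⟨![1, A 1 0 / A 0 0], A 0, ?_⟩
      ext i j
      fin_cases i
      · simp [Matrix.vecMulVec_apply]
      · fin_cases j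
        · simp [Matrix.vecMulVec_apply, h00]
        · simp [Matrix.vecMulVec_apply]
          field_simp
          linarith

/-- Up to translating on both sides by the group, a non-zero singular matrix acts on the real line
as the constant map to a point of its domain. -/
lemma exists_translate_fixing {Γ : Subgroup SL(2, ℝ)} (hPH : PurelyHyperbolic Γ)
    (hNE : IsNonElementary Γ) {A : Matrix (Fin 2) (Fin 2) ℝ} (hA : A ≠ 0) (hdet : A.det = 0) :
    ∃ g ∈ Γ, ∃ h ∈ Γ, ∃ x₀ : ℝ,
      realDenom ((g : Matrix (Fin 2) (Fin 2) ℝ) * A * (h : Matrix (Fin 2) (Fin 2) ℝ)) x₀ ≠ 0 ∧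
      realMobius ((g : Matrix (Fin 2) (Fin 2) ℝ) * A * (h : Matrix (Fin 2) (Fin 2) ℝ)) x₀ = x₀ := by
  obtain ⟨u, v, hu, hv, rfl⟩ := exists_eq_vecMulVec hA hdet
  obtain ⟨g, hg, hgu⟩ : ∃ g ∈ Γ, ((g : Matrix (Fin 2) (Fin 2) ℝ) *ᵥ u) 1 ≠ 0 := by
    by_cases hu1 : u 1 = 0
    · obtain ⟨g, hg, hgu⟩ := exists_mulVec_not_parallel hPH hNE hu
      have hu0 : u 0 ≠ 0 := fun hu0 => hu (by ext j; fin_cases j <;> assumption)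
      refine ⟨g, hg, fun h1 => hgu (((g : Matrix (Fin 2) (Fin 2) ℝ) *ᵥ u) 0 / u 0) ?_⟩
      ext j
      fin_cases j
      · simp [hu0]
      · simp [hu1, h1]
    · exact ⟨1, Γ.one_mem, by simpa using hu1⟩
  set u' := (g : Matrix (Fin 2) (Fin 2) ℝ) *ᵥ u with hu'
  have hu'0 : u' ≠ 0 := fun h => hgu (by rw [h]; rfl)
  obtain ⟨h, hh, hvh⟩ : ∃ h ∈ Γ, v ⬝ᵥ ((h : Matrix (Fin 2) (Fin 2) ℝ) *ᵥ u') ≠ 0 := by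
    by_cases hvu : v ⬝ᵥ u' = 0
    · obtain ⟨h, hh, hhu⟩ := exists_mulVec_not_parallel hPH hNE hu'0
      refine ⟨h, hh, fun h0 => hhu (((h : Matrix (Fin 2) (Fin 2) ℝ) *ᵥ u') 1 / u' 1) ?_⟩
      set z := (h : Matrix (Fin 2) (Fin 2) ℝ) *ᵥ u'
      simp only [dotProduct, Fin.sum_univ_two] at hvu h0
      have hv0 : v 0 ≠ 0 := by
        intro hv0
        refine hv ?_
        ext j
        fin_cases j
        · exact hv0
        · rw [hv0] at hvu
          simpa [hgu] using hvu
      ext j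
      fin_cases j
      · simp only [Fin.zero_eta, Pi.smul_apply, smul_eq_mul]
        field_simp
        apply mul_left_cancel₀ hv0
        linear_combination u' 1 * h0 - z 1 * hvu
      · simp [hgu]
    · exact ⟨1, Γ.one_mem, by simpa using hvu⟩
  refine ⟨g, hg, h, hh, u' 0 / u' 1, ?_⟩
  have hB : (g : Matrix (Fin 2) (Fin 2) ℝ) * Matrix.vecMulVec u v *
      (h : Matrix (Fin 2) (Fin 2) ℝ) = Matrix.vecMulVec u' (v ᵥ* (h : Matrix (Fin 2) (Fin 2) ℝ)) := by
    rw [Matrix.mul_vecMulVec, Matrix.vecMulVec_mul]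
  rw [hB]
  rw [Matrix.dotProduct_mulVec] at hvh
  set q := v ᵥ* (h : Matrix (Fin 2) (Fin 2) ℝ)
  simp only [dotProduct, Fin.sum_univ_two] at hvh
  have hden : realDenom (Matrix.vecMulVec u' q) (u' 0 / u' 1) = q 0 * u' 0 + q 1 * u' 1 := by
    simp only [realDenom, Matrix.vecMulVec_apply]
    field_simp
  refine ⟨by rwa [hden], ?_⟩
  rw [realMobius, hden, div_eq_div_iff hvh hgu]
  simp only [Matrix.vecMulVec_apply]
  field_simp

lemma eventually_contraction {B : Matrix (Fin 2) (Fin 2) ℝ} {x₀ : ℝ} (hden : realDenom B x₀ ≠ 0)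
    (hfix : realMobius B x₀ = x₀) :
    ∃ ρ > 0, ∃ κ₁ > 0, ∃ κ₂ > 0, ∃ T₀ : ℝ, ∀ᶠ M in 𝓝 B, ∀ (g : SL(2, ℝ)) (T : ℝ), T₀ ≤ T →
      (g : Matrix (Fin 2) (Fin 2) ℝ) = T • M → ContractsInto x₀ ρ g ∧
        ∀ x ∈ Metric.closedBall x₀ ρ, κ₁ * T ≤ |realDenom g x| ∧ |realDenom g x| ≤ κ₂ * T := by
  set κ := |realDenom B x₀| with hκ
  have hκ0 : 0 < κ := abs_pos.2 hden
  have hcont : Continuous fun p : Matrix (Fin 2) (Fin 2) ℝ × ℝ => |realDenom p.1 p.2| := by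
    unfold realDenom
    fun_prop
  have h1 : ∀ᶠ p : Matrix (Fin 2) (Fin 2) ℝ × ℝ in 𝓝 (B, x₀),
      |realDenom p.1 p.2| ∈ Ioo (κ / 2) (2 * κ) :=
    hcont.continuousAt.eventually_mem (Ioo_mem_nhds (by linarith) (by linarith))
  rw [nhds_prod_eq] at h1
  obtain ⟨U, hU, V, hV, hUV⟩ := eventually_prod_iff.1 h1
  obtain ⟨ρ, hρ, hρV⟩ := Metric.nhds_basis_closedBall.eventually_iff.1 hV
  have h2 : ∀ᶠ M in 𝓝 B, dist (realMobius M x₀) x₀ < ρ / 4 := by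
    have : ContinuousAt (fun M : Matrix (Fin 2) (Fin 2) ℝ => realMobius M x₀) B := by
      refine ContinuousAt.div (by fun_prop) ?_ hden
      unfold realDenom
      fun_prop
    have h3 := this.eventually_mem (Metric.ball_mem_nhds _ (show 0 < ρ / 4 by positivity))
    rwa [hfix] at h3
  refine ⟨ρ, hρ, κ / 2, by positivity, 2 * κ, by positivity, 4 / κ, ?_⟩
  filter_upwards [hU, h2] with M hMU hM g T hT hg
  have hT0 : 0 < T := lt_of_lt_of_le (by positivity) hT
  have hdenT : ∀ x, realDenom g x = T * realDenom M x := fun x => by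
    rw [hg]; simp only [realDenom, Matrix.smul_apply, smul_eq_mul]; ring
  have hmob : ∀ x, realMobius g x = realMobius M x := fun x => by
    rw [realMobius, hdenT, realMobius, hg, ← mul_div_mul_left _ (realDenom M x) hT0.ne']
    congr 1
    simp only [Matrix.smul_apply, smul_eq_mul]
    ring
  have hb : ∀ x ∈ Metric.closedBall x₀ ρ,
      κ / 2 * T ≤ |realDenom g x| ∧ |realDenom g x| ≤ 2 * κ * T := by
    intro x hx
    have := hUV hMU (hρV hx)
    rw [hdenT, abs_mul, abs_of_pos hT0, mul_comm T]
    exact ⟨by have := this.1; gcongr, by have := this.2; gcongr⟩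
  have hκT : 2 ≤ κ / 2 * T := by
    rw [div_le_iff₀ hκ0] at hT
    linarith
  have hx₀ := Metric.mem_closedBall_self (x := x₀) hρ.le
  have h2le : ∀ x ∈ Metric.closedBall x₀ ρ, 2 ≤ |realDenom g x| := fun x hx =>
    hκT.trans (hb x hx).1
  refine ⟨fun x hx => ⟨h2le x hx, ?_⟩, hb⟩
  have hsub := realMobius_sub g (abs_pos.1 (two_pos.trans_le (h2le x hx)))
    (abs_pos.1 (two_pos.trans_le (h2le x₀ hx₀)))
  have h4 : dist (realMobius g x) (realMobius g x₀) ≤ ρ / 4 := by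
    rw [Real.dist_eq, hsub, abs_div, abs_mul, div_le_iff₀ (by
      have := h2le x hx; have := h2le x₀ hx₀; positivity)]
    rw [Metric.mem_closedBall, Real.dist_eq] at hx
    have := mul_le_mul (h2le x hx) (h2le x₀ hx₀) (by norm_num) (abs_nonneg _)
    nlinarith
  rw [← hmob] at hM
  rw [Metric.mem_closedBall]
  linarith [dist_triangle (realMobius g x) (realMobius g x₀) x₀]

/-! ### Concentration of the orbit in matrix space -/

/-- The sum of the squares of the entries of a matrix. -/
def sumSq (M : Matrix (Fin 2) (Fin 2) ℝ) : ℝ :=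
  M 0 0 ^ 2 + M 0 1 ^ 2 + M 1 0 ^ 2 + M 1 1 ^ 2

lemma two_mul_cosh_dist_smul_I (g : SL(2, ℝ)) :
    2 * Real.cosh (dist UpperHalfPlane.I (g • UpperHalfPlane.I)) = sumSq g := by
  have hdet : g 0 0 * g 1 1 - g 0 1 * g 1 0 = 1 := by
    rw [← Matrix.det_fin_two]; exact g.det_coe
  unfold sumSq
  have hz := UpperHalfPlane.coe_specialLinearGroup_apply g UpperHalfPlane.I
  generalize g 0 0 = a at *
  generalize g 0 1 = b at *
  generalize g 1 0 = c at *
  generalize g 1 1 = d at *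
  have hcd : 0 < c ^ 2 + d ^ 2 := by
    by_contra! h
    have hc : c = 0 := by nlinarith [sq_nonneg c, sq_nonneg d]
    have hd : d = 0 := by nlinarith [sq_nonneg c, sq_nonneg d]
    rw [hc, hd] at hdet
    simp at hdet
  generalize g • UpperHalfPlane.I = w at *
  have hden : (algebraMap ℝ ℝ c : ℂ) * UpperHalfPlane.I + (algebraMap ℝ ℝ d : ℂ) ≠ 0 := by
    intro h0
    have him := congrArg Complex.im h0
    have hre := congrArg Complex.re h0
    simp at him hre
    simp [him, hre] at hcd
  rw [eq_div_iff hden] at hz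
  have him := congrArg Complex.im hz
  have hre := congrArg Complex.re hz
  simp at him hre
  have hwim : w.im = 1 / (c ^ 2 + d ^ 2) := by
    field_simp
    linear_combination d * him - c * hre + hdet
  have hwre : w.re = (a * c + b * d) / (c ^ 2 + d ^ 2) := by
    field_simp
    linear_combination c * him + d * hre
  rw [dist_comm, UpperHalfPlane.cosh_dist', hwim, hwre]
  simp only [UpperHalfPlane.I_re, UpperHalfPlane.I_im, sub_zero, one_pow, mul_one]
  field_simp
  linear_combination (-(a * d - b * c) - 1) * hdet

lemma isCompact_sumSq_mem_Icc : IsCompact {M : Matrix (Fin 2) (Fin 2) ℝ | sumSq M ∈ Icc 1 2} := by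
  have hcomp : IsCompact (Set.univ.pi fun _ : Fin 2 => Set.univ.pi fun _ : Fin 2 =>
      Icc (-2 : ℝ) 2) :=
    isCompact_univ_pi fun _ => isCompact_univ_pi fun _ => isCompact_Icc
  refine hcomp.of_isClosed_subset (isClosed_Icc.preimage (by unfold sumSq; fun_prop)) ?_
  rintro M ⟨-, hM⟩ i - j -
  unfold sumSq at hM
  refine abs_le.1 (abs_le_of_sq_le_sq ?_ zero_le_two)
  fin_cases i <;> fin_cases j <;> dsimp <;>
    linarith [sq_nonneg (M 0 0), sq_nonneg (M 0 1), sq_nonneg (M 1 0), sq_nonneg (M 1 1)]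

/-- A non-summable family indexed by points of a compact set is non-summable near some point. -/
lemma IsCompact.exists_not_summable_indicator {ι E : Type*} [TopologicalSpace E] {K : Set E}
    (hK : IsCompact K) {φ : ι → E} (hφ : ∀ i, φ i ∈ K) {w : ι → ℝ} (hw : ¬ Summable w) :
    ∃ A ∈ K, ∀ U ∈ 𝓝 A, ¬ Summable ((φ ⁻¹' U).indicator w) := by
  by_contra! h
  refine hw ?_
  have : Summable ((φ ⁻¹' K).indicator w) := by
    refine hK.induction_on (p := fun s => Summable ((φ ⁻¹' s).indicator w)) ?_ ?_ ?_ ?_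
    · simp [summable_zero]
    · intro s t hst ht
      have := ht.indicator (φ ⁻¹' s)
      rwa [Set.indicator_indicator, inter_eq_left.2 (preimage_mono hst)] at this
    · intro s t hs ht
      rw [← union_sdiff_self, preimage_union,
        Set.indicator_union_of_disjoint (disjoint_sdiff_right.preimage φ)]
      refine hs.add ?_
      have := ht.indicator (φ ⁻¹' sᶜ)
      rwa [Set.indicator_indicator, inter_comm, ← preimage_inter, ← Set.sdiff_eq] at this
    · intro A hA
      obtain ⟨U, hU, hsum⟩ := h A hA
      exact ⟨U, mem_nhdsWithin_of_mem_nhds hU, hsum⟩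
  rwa [eq_univ_of_forall (s := φ ⁻¹' K) hφ, Set.indicator_univ] at this

lemma summable_indicator_of_finite {ι : Type*} {S : Set ι} (hS : S.Finite) (w : ι → ℝ) :
    Summable (S.indicator w) :=
  summable_of_hasFiniteSupport (hS.subset Set.support_indicator_subset)

/-- The distance by which an element of `SL(2, ℝ)` displaces the point `i`. -/
def displacement (g : SL(2, ℝ)) : ℝ :=
  dist UpperHalfPlane.I (g • UpperHalfPlane.I)

lemma displacement_nonneg (g : SL(2, ℝ)) : 0 ≤ displacement g := dist_nonneg

/-- The orbit, renormalised in matrix space, accumulates with infinite Poincaré mass at a non-zero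
singular matrix. -/
lemma exists_singular_concentration {Γ : Subgroup SL(2, ℝ)} (hdisc : DiscreteTopology Γ) {s : ℝ}
    (hs : ¬ Summable fun γ : Γ => Real.exp (-s * displacement γ)) :
    ∃ A : Matrix (Fin 2) (Fin 2) ℝ, A ≠ 0 ∧ A.det = 0 ∧ ∀ U ∈ 𝓝 A,
      ¬ Summable ({γ : Γ | Real.exp (-displacement γ / 2) •
        ((γ : SL(2, ℝ)) : Matrix (Fin 2) (Fin 2) ℝ) ∈ U}.indicator
          fun γ => Real.exp (-s * displacement γ)) := by
  have hmem : ∀ γ : Γ, Real.exp (-displacement γ / 2) •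
      ((γ : SL(2, ℝ)) : Matrix (Fin 2) (Fin 2) ℝ) ∈
        {M : Matrix (Fin 2) (Fin 2) ℝ | sumSq M ∈ Icc 1 2} := by
    intro γ
    have h1 := two_mul_cosh_dist_smul_I γ
    change 2 * Real.cosh (displacement γ) = _ at h1
    have h2 : sumSq (Real.exp (-displacement γ / 2) •
        ((γ : SL(2, ℝ)) : Matrix (Fin 2) (Fin 2) ℝ)) =
          1 + Real.exp (-displacement γ) * Real.exp (-displacement γ) := by
      have h3 : Real.exp (-displacement γ / 2) ^ 2 = Real.exp (-displacement γ) := by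
        rw [← Real.exp_nat_mul]; congr 1; push_cast; ring
      calc _ = Real.exp (-displacement γ / 2) ^ 2 *
            sumSq ((γ : SL(2, ℝ)) : Matrix (Fin 2) (Fin 2) ℝ) := by
            simp only [sumSq, Matrix.smul_apply, smul_eq_mul]; ring
        _ = _ := by
            rw [← h1, h3, Real.cosh_eq, mul_div_cancel₀ _ two_ne_zero, mul_add, ← Real.exp_add]
            simp
    have h4 : Real.exp (-displacement γ) ≤ 1 :=
      Real.exp_le_one_iff.2 (neg_nonpos.2 (displacement_nonneg _))
    have h5 := Real.exp_pos (-displacement γ)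
    rw [mem_ofPred_eq, h2]
    constructor <;> nlinarith
  obtain ⟨A, hA, hconc⟩ := IsCompact.exists_not_summable_indicator isCompact_sumSq_mem_Icc hmem hs
  refine ⟨A, ?_, ?_, hconc⟩
  · rintro rfl
    norm_num [sumSq] at hA
  · by_contra hdet
    have hU : {M : Matrix (Fin 2) (Fin 2) ℝ | |A.det| / 2 < |M.det|} ∈ 𝓝 A :=
      (continuous_id.matrix_det.abs).continuousAt.eventually (lt_mem_nhds (half_lt_self
        (abs_pos.2 hdet)))
    refine hconc _ hU (summable_indicator_of_finite
      ((finite_dist_smul_I_le Γ hdisc (-Real.log (|A.det| / 2))).subset ?_) _)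
    intro γ hγ
    simp only [mem_preimage, mem_ofPred_eq, Matrix.det_smul, Fintype.card_fin,
      Matrix.SpecialLinearGroup.det_coe, mul_one, abs_pow, Real.abs_exp] at hγ
    rw [← Real.exp_nat_mul, ← Real.log_lt_iff_lt_exp (by positivity)] at hγ
    push_cast at hγ
    change displacement γ ≤ _
    linarith

/-! ### Extracting many elements of comparable displacement -/

lemma exists_large_level {ι : Type*} {d : ι → ℝ} (hd : ∀ i, 0 ≤ d i) {S : Set ι} {s t : ℝ}
    (hs : 0 ≤ s) (hst : s < t) (hS : ¬ Summable (S.indicator fun i => Real.exp (-t * d i)))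
    (C : ℝ) : ∃ (n : ℕ) (F : Finset ι), ↑F ⊆ S ∧ (∀ i ∈ F, ⌊d i⌋₊ = n) ∧
      C * Real.exp (s * n) ≤ F.card := by
  classical
  by_contra! h
  have hr : Real.exp (-(t - s)) < 1 := Real.exp_lt_one_iff.2 (by linarith)
  have hgeo := summable_geometric_of_lt_one (Real.exp_pos _).le hr
  refine hS (summable_of_sum_le (c := ∑' n : ℕ, C * Real.exp (-(t - s)) ^ n)
    (fun i => Set.indicator_nonneg (fun _ _ => (Real.exp_pos _).le) i) fun u => ?_)
  have h1 : ∑ i ∈ u, S.indicator (fun i => Real.exp (-t * d i)) i =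
      ∑ i ∈ u with i ∈ S, Real.exp (-t * d i) := by
    rw [Finset.sum_filter]
    rfl
  rw [h1]
  set v := u.filter (· ∈ S)
  have hC : 0 ≤ C := by
    have := h 0 ∅ (by simp) (by simp)
    simp at this
    exact this.le
  rw [← Finset.sum_fiberwise_of_maps_to (t := v.image fun i => ⌊d i⌋₊)
    (fun i hi => Finset.mem_image_of_mem _ hi)]
  refine (Finset.sum_le_sum fun n _ => ?_).trans ((hgeo.mul_left C).sum_le_tsum _
    fun n _ => by positivity)
  have h2 : ∀ i ∈ v.filter (fun i => ⌊d i⌋₊ = n), Real.exp (-t * d i) ≤ Real.exp (-t * n) := by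
    intro i hi
    have h3 := Nat.floor_le (hd i)
    rw [(Finset.mem_filter.1 hi).2] at h3
    rw [Real.exp_le_exp]
    nlinarith
  refine (Finset.sum_le_card_nsmul _ _ _ h2).trans ?_
  have h4 := h n (v.filter (fun i => ⌊d i⌋₊ = n))
    (fun i hi => (Finset.mem_filter.1 (Finset.mem_filter.1 hi).1).2)
    (fun i hi => (Finset.mem_filter.1 hi).2)
  rw [nsmul_eq_mul]
  calc _ ≤ C * Real.exp (s * n) * Real.exp (-t * n) := by gcongr
    _ = _ := by
      rw [mul_assoc, ← Real.exp_add, ← Real.exp_nat_mul]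
      congr 2
      ring

/-- A greedy selection of pairwise unrelated elements. -/
lemma exists_pairwise_unrelated {ι : Type*} [DecidableEq ι] {r : ι → ι → Prop} [DecidableRel r]
    (hsymm : ∀ i j, r i j → r j i) (N : ℕ) (S : Finset ι)
    (hN : ∀ i ∈ S, (S.filter fun j => j = i ∨ r i j).card ≤ N) :
    ∃ F ⊆ S, (F : Set ι).Pairwise (fun i j => ¬ r i j) ∧ S.card ≤ N * F.card := by
  induction S using Finset.strongInduction with
  | H S ih =>
    rcases S.eq_empty_or_nonempty with rfl | ⟨i, hi⟩
    · exact ⟨∅, by simp⟩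
    set S' := S.filter fun j => ¬ (j = i ∨ r i j) with hS'
    have hsub : S' ⊆ S := Finset.filter_subset _ _
    have hiS' : i ∉ S' := by simp [hS']
    obtain ⟨F, hF, hpair, hcard⟩ := ih S' ⟨hsub, fun h => hiS' (h hi)⟩ fun j hj =>
      (Finset.card_le_card (Finset.filter_subset_filter _ hsub)).trans (hN j (hsub hj))
    have hnot : ∀ j ∈ F, ¬ r i j := fun j hj h => (Finset.mem_filter.1 (hF hj)).2 (Or.inr h)
    refine ⟨insert i F, Finset.insert_subset hi (hF.trans hsub), ?_, ?_⟩
    · rw [Finset.coe_insert, Set.pairwise_insert]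
      exact ⟨hpair, fun j hj _ => ⟨hnot j hj, fun h => hnot j hj (hsymm _ _ h)⟩⟩
    · rw [Finset.card_insert_of_notMem fun h => hiS' (hF h), mul_add, mul_one,
        ← Finset.card_filter_add_card_filter_not (s := S) (fun j => j = i ∨ r i j), add_comm]
      exact add_le_add hcard (hN i hi)

/-! ### The lower bound -/

lemma displacement_inv_mul (a b : SL(2, ℝ)) :
    displacement (a⁻¹ * b) = dist (a • UpperHalfPlane.I) (b • UpperHalfPlane.I) := by
  rw [displacement, mul_smul, ← dist_smul a, smul_inv_smul]

/-- If two elements of comparable size map points of `closedBall x₀ ρ` to the same point, then they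
move `i` to nearby points. -/
lemma exists_dist_smul_I_le_of_realMobius_eq {x₀ ρ κ₁ κ₂ : ℝ} (hρ : 0 < ρ) (hκ₁ : 0 < κ₁)
    (hκ₂ : 0 < κ₂) : ∃ R : ℝ, ∀ (g g' : SL(2, ℝ)) (t t' : ℝ), |t - t'| ≤ 1 →
      (∀ x ∈ Metric.closedBall x₀ ρ,
        κ₁ * Real.exp t ≤ |realDenom g x| ∧ |realDenom g x| ≤ κ₂ * Real.exp t) →
      (∀ x ∈ Metric.closedBall x₀ ρ,
        κ₁ * Real.exp t' ≤ |realDenom g' x| ∧ |realDenom g' x| ≤ κ₂ * Real.exp t') →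
      ∀ y ∈ Metric.closedBall x₀ ρ, ∀ y' ∈ Metric.closedBall x₀ ρ,
        realMobius g y = realMobius g' y' →
          dist (g • UpperHalfPlane.I) (g' • UpperHalfPlane.I) ≤ R := by
  set R₀ := Real.log (((|x₀| + ρ + 1) ^ 2 + 2) * (1 + (κ₂ / (κ₁ * ρ)) ^ 2))
  have key : ∀ (g : SL(2, ℝ)) (t : ℝ), (∀ x ∈ Metric.closedBall x₀ ρ,
      κ₁ * Real.exp t ≤ |realDenom g x| ∧ |realDenom g x| ≤ κ₂ * Real.exp t) →
      ∀ y ∈ Metric.closedBall x₀ ρ, ∃ h : realDenom g y ≠ 0,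
        dist (g • UpperHalfPlane.I) (shadowPoint g y h) ≤ R₀ ∧
        Real.log κ₁ + t ≤ Real.log |realDenom g y| ∧
          Real.log |realDenom g y| ≤ Real.log κ₂ + t := by
    intro g t hg y hy
    have hpos : 0 < κ₁ * Real.exp t := by positivity
    have hne : ∀ x ∈ Metric.closedBall x₀ ρ, realDenom g x ≠ 0 := fun x hx =>
      abs_pos.1 (hpos.trans_le (hg x hx).1)
    have hD := hg y hy
    refine ⟨hne y hy, (dist_smul_I_shadowPoint_le g y (hne y hy)).trans ?_, ?_, ?_⟩
    · have hc := (abs_mul_le_abs_realDenom hne).trans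
        (hg x₀ (Metric.mem_closedBall_self hρ.le)).2
      have h1 : |g 1 0 / realDenom g y| ≤ κ₂ / (κ₁ * ρ) := by
        rw [abs_div, div_le_div_iff₀ (hpos.trans_le hD.1) (by positivity)]
        calc |g 1 0| * (κ₁ * ρ) = κ₁ * (|g 1 0| * ρ) := by ring
          _ ≤ κ₁ * (κ₂ * Real.exp t) := by gcongr
          _ = κ₂ * (κ₁ * Real.exp t) := by ring
          _ ≤ _ := by gcongr; exact hD.1
      have h2 : (g 1 0 / realDenom g y) ^ 2 ≤ (κ₂ / (κ₁ * ρ)) ^ 2 := by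
        rw [← sq_abs]; gcongr
      have h3 : |y| ≤ |x₀| + ρ := by
        rw [Metric.mem_closedBall, Real.dist_eq] at hy
        linarith [abs_sub_abs_le_abs_sub y x₀]
      apply Real.log_le_log (by positivity)
      gcongr
    · rw [← Real.log_exp t, ← Real.log_mul hκ₁.ne' (Real.exp_pos _).ne']
      exact Real.log_le_log hpos hD.1
    · rw [← Real.log_exp t, ← Real.log_mul hκ₂.ne' (Real.exp_pos _).ne']
      exact Real.log_le_log (hpos.trans_le hD.1) hD.2
  refine ⟨R₀ + 2 * (Real.log κ₂ - Real.log κ₁ + 1) + R₀, ?_⟩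
  intro g g' t t' htt hg hg' y hy y' hy' hyy
  obtain ⟨h, h1, h2, h3⟩ := key g t hg y hy
  obtain ⟨h', h1', h2', h3'⟩ := key g' t' hg' y' hy'
  have h4 : dist (shadowPoint g y h) (shadowPoint g' y' h') ≤
      2 * (Real.log κ₂ - Real.log κ₁ + 1) := by
    rw [UpperHalfPlane.dist_of_re_eq (by exact hyy)]
    change dist (Real.log (1 / realDenom g y ^ 2)) (Real.log (1 / realDenom g' y' ^ 2)) ≤ _
    rw [one_div, one_div, Real.log_inv, Real.log_inv, Real.log_pow, Real.log_pow,
      ← Real.log_abs (realDenom g y), ← Real.log_abs (realDenom g' y'), Real.dist_eq, abs_le]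
    rw [abs_le] at htt
    push_cast
    constructor <;> linarith
  calc _ ≤ dist (g • UpperHalfPlane.I) (shadowPoint g y h) +
        dist (shadowPoint g y h) (shadowPoint g' y' h') +
        dist (shadowPoint g' y' h') (g' • UpperHalfPlane.I) := dist_triangle4 _ _ _ _
    _ ≤ _ := by rw [dist_comm (shadowPoint g' y' h')]; gcongr

/-- Below a divergence exponent there are arbitrarily rich finite families of elements of `Γ`
contracting an interval into pairwise disjoint subintervals. -/
lemma exists_disjoint_contractions {Γ : Subgroup SL(2, ℝ)} (hdisc : DiscreteTopology Γ)
    (hPH : PurelyHyperbolic Γ) (hNE : IsNonElementary Γ) {s t : ℝ} (hs : 0 < s) (hst : s < t)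
    (hsum : ¬ Summable fun γ : Γ => Real.exp (-t * displacement γ)) :
    ∃ (x₀ ρ P : ℝ) (F : Finset SL(2, ℝ)), 0 < ρ ∧ 0 < P ∧ 1 < F.card ∧ P ^ s ≤ F.card ∧
      (∀ g ∈ F, g ∈ Γ ∧ ContractsInto x₀ ρ g ∧ ∀ x ∈ Metric.closedBall x₀ ρ,
        |realDenom g x| ^ 2 ≤ P) ∧
      (F : Set SL(2, ℝ)).Pairwise fun g g' => Disjoint (realMobius g '' Metric.closedBall x₀ ρ)
        (realMobius g' '' Metric.closedBall x₀ ρ) := by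
  classical
  obtain ⟨A, hA, hdet, hconc⟩ := exists_singular_concentration hdisc hsum
  obtain ⟨g, hg, h, hh, x₀, hden, hfix⟩ := exists_translate_fixing hPH hNE hA hdet
  obtain ⟨ρ, hρ, κ₁, hκ₁, κ₂, hκ₂, T₀, hev⟩ := eventually_contraction hden hfix
  obtain ⟨R, hR⟩ := exists_dist_smul_I_le_of_realMobius_eq (x₀ := x₀) hρ hκ₁ hκ₂
  set U : Set (Matrix (Fin 2) (Fin 2) ℝ) := {M | ∀ (k : SL(2, ℝ)) (T : ℝ), T₀ ≤ T →
    (k : Matrix (Fin 2) (Fin 2) ℝ) = T • ((g : Matrix (Fin 2) (Fin 2) ℝ) * M *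
      (h : Matrix (Fin 2) (Fin 2) ℝ)) → ContractsInto x₀ ρ k ∧
        ∀ x ∈ Metric.closedBall x₀ ρ, κ₁ * T ≤ |realDenom k x| ∧ |realDenom k x| ≤ κ₂ * T}
  have hU : U ∈ 𝓝 A := by
    have hcont : Continuous fun M : Matrix (Fin 2) (Fin 2) ℝ =>
        (g : Matrix (Fin 2) (Fin 2) ℝ) * M * (h : Matrix (Fin 2) (Fin 2) ℝ) := by fun_prop
    exact hcont.continuousAt.eventually hev
  set V : Set Γ := {γ : Γ | Real.exp (-displacement γ / 2) •
        ((γ : SL(2, ℝ)) : Matrix (Fin 2) (Fin 2) ℝ) ∈ U}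
  set W : Set Γ := {γ : Γ | T₀ ≤ Real.exp (displacement γ / 2)}
  set S : Set Γ := V ∩ W
  have hS : ¬ Summable (S.indicator fun γ : Γ => Real.exp (-t * displacement γ)) := by
    intro hS
    refine hconc U hU ?_
    change Summable (V.indicator _)
    have hdisj : Disjoint (V ∩ W) (V \ W) := disjoint_inf_sdiff
    rw [← inter_union_sdiff V W, Set.indicator_union_of_disjoint hdisj]
    refine hS.add (summable_indicator_of_finite
      ((finite_dist_smul_I_le Γ hdisc (2 * T₀)).subset ?_) _)
    rintro γ ⟨-, hγ⟩
    rw [mem_ofPred_eq, not_le] at hγ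
    change displacement γ ≤ _
    linarith [Real.add_one_le_exp (displacement γ / 2)]
  set η : Γ → SL(2, ℝ) := fun γ => g * γ * h
  have hη : ∀ γ, η γ ∈ Γ := fun γ => Γ.mul_mem (Γ.mul_mem hg γ.2) hh
  have hηS : ∀ γ ∈ S, ContractsInto x₀ ρ (η γ) ∧ ∀ x ∈ Metric.closedBall x₀ ρ,
      κ₁ * Real.exp (displacement γ / 2) ≤ |realDenom (η γ) x| ∧
        |realDenom (η γ) x| ≤ κ₂ * Real.exp (displacement γ / 2) := by
    rintro γ ⟨hγU, hγT⟩
    refine hγU (η γ) _ hγT ?_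
    rw [Matrix.mul_smul, Matrix.smul_mul, smul_smul, ← Real.exp_add]
    simp [η, neg_div]
  have hfin := finite_dist_smul_I_le Γ hdisc R
  set N := hfin.toFinset.card + 1
  obtain ⟨n, F₀, hF₀S, hF₀n, hF₀card⟩ := exists_large_level (fun γ : Γ => displacement_nonneg γ)
    hs.le hst hS (N * (2 + (κ₂ ^ 2 * Real.exp 1) ^ s))
  set r : Γ → Γ → Prop := fun γ γ' => ¬ Disjoint (realMobius (η γ) '' Metric.closedBall x₀ ρ)
    (realMobius (η γ') '' Metric.closedBall x₀ ρ)
  have hrefl : ∀ γ, r γ γ := fun γ => by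
    simp only [r, disjoint_self, bot_eq_empty, image_eq_empty]
    exact (Metric.nonempty_closedBall.2 hρ.le).ne_empty
  obtain ⟨F, hF, hpair, hcard⟩ := exists_pairwise_unrelated (r := r)
    (fun i j hij hji => hij hji.symm) N F₀ (by
      intro i hi
      refine (Finset.card_le_card_of_injOn (t := hfin.toFinset)
        (fun j => (⟨h, hh⟩ : Γ)⁻¹ * i⁻¹ * j * ⟨h, hh⟩) ?_ ?_).trans (Nat.le_succ _)
      · intro j hj
        rw [Finset.mem_coe, Finset.mem_filter] at hj
        obtain ⟨hj, hij⟩ := hj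
        have hij : r i j := by
          rcases hij with rfl | hij
          exacts [hrefl _, hij]
        obtain ⟨_, ⟨y, hy, rfl⟩, y', hy', hyy⟩ := not_disjoint_iff.1 hij
        rw [Finset.mem_coe, Set.Finite.mem_toFinset]
        have h1 := hR (η i) (η j) _ _ ?_ (hηS i (hF₀S hi)).2 (hηS j (hF₀S hj)).2 y hy y' hy'
          hyy.symm
        · rw [← displacement_inv_mul] at h1
          have h2 : (((⟨h, hh⟩ : Γ)⁻¹ * i⁻¹ * j * ⟨h, hh⟩ : Γ) : SL(2, ℝ)) = (η i)⁻¹ * η j := by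
            simp only [η, Subgroup.coe_mul, Subgroup.coe_inv]
            group
          change displacement (((⟨h, hh⟩ : Γ)⁻¹ * i⁻¹ * j * ⟨h, hh⟩ : Γ) : SL(2, ℝ)) ≤ R
          rwa [h2]
        · have h3 := Nat.floor_le (displacement_nonneg i)
          have h4 := Nat.lt_floor_add_one (displacement i)
          have h5 := Nat.floor_le (displacement_nonneg j)
          have h6 := Nat.lt_floor_add_one (displacement j)
          rw [hF₀n i hi] at h3 h4
          rw [hF₀n j hj] at h5 h6
          rw [abs_le]
          constructor <;> linarith
      · intro j _ j' _ hjj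
        simpa using hjj)
  have hηinj : Function.Injective η := fun γ γ' hγ => by simpa [η] using hγ
  have hN : (0 : ℝ) < N := by positivity
  have hFcard : (2 + (κ₂ ^ 2 * Real.exp 1) ^ s) * Real.exp (s * n) ≤ F.card := by
    have h1 : (F₀.card : ℝ) ≤ N * F.card := by exact_mod_cast hcard
    rw [mul_assoc] at hF₀card
    exact le_of_mul_le_mul_left (hF₀card.trans h1) hN
  have hexp1 : 1 ≤ Real.exp (s * n) := Real.one_le_exp (by positivity)
  have hPs : 0 < (κ₂ ^ 2 * Real.exp 1) ^ s := by positivity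
  refine ⟨x₀, ρ, κ₂ ^ 2 * Real.exp 1 * Real.exp n, F.image η, hρ, by positivity, ?_, ?_, ?_, ?_⟩
  · rw [Finset.card_image_of_injective _ hηinj]
    have : (1 : ℝ) < F.card := by nlinarith
    exact_mod_cast this
  · rw [Finset.card_image_of_injective _ hηinj, Real.mul_rpow (by positivity) (by positivity),
      ← Real.exp_mul, mul_comm (n : ℝ)]
    nlinarith
  · intro k hk
    obtain ⟨γ, hγ, rfl⟩ := Finset.mem_image.1 hk
    have hγS := hηS γ (hF₀S (hF hγ))
    refine ⟨hη γ, hγS.1, fun x hx => ?_⟩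
    have h4 := Nat.lt_floor_add_one (displacement γ)
    rw [hF₀n γ (hF hγ)] at h4
    calc |realDenom (η γ) x| ^ 2 ≤ (κ₂ * Real.exp (displacement γ / 2)) ^ 2 := by
          have := (hγS.2 x hx).2
          gcongr
      _ = κ₂ ^ 2 * Real.exp (displacement γ) := by
          rw [mul_pow, ← Real.exp_nat_mul]; congr 2; push_cast; ring
      _ ≤ κ₂ ^ 2 * Real.exp (n + 1) := by gcongr
      _ = _ := by rw [Real.exp_add]; ring
  · intro k hk k' hk' hkk
    obtain ⟨γ, hγ, rfl⟩ := Finset.mem_image.1 (Finset.mem_coe.1 hk)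
    obtain ⟨γ', hγ', rfl⟩ := Finset.mem_image.1 (Finset.mem_coe.1 hk')
    exact not_not.1 (hpair hγ hγ' fun h => hkk (by rw [h]))

theorem le_dimH_conical {Γ : Subgroup SL(2, ℝ)} (hdisc : DiscreteTopology Γ)
    (hPH : PurelyHyperbolic Γ) (hNE : IsNonElementary Γ) {s t : ℝ} (hs : 0 < s) (hst : s < t)
    (hsum : ¬ Summable fun γ : Γ => Real.exp (-t * displacement γ)) :
    ENNReal.ofReal s ≤ dimH {x | IsConicalLimitPoint Γ (projPt x)} := by
  obtain ⟨x₀, ρ, P, F, hρ, hP, hF1, hPF, hF, hdisj⟩ :=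
    exists_disjoint_contractions hdisc hPH hNE hs hst hsum
  set k : Fin F.card → SL(2, ℝ) := fun j => F.equivFin.symm j
  have hk : ∀ j, k j ∈ F := fun j => (F.equivFin.symm j).2
  have hcon : ∀ j, ContractsInto x₀ ρ (k j) := fun j => (hF _ (hk j)).2.1
  refine le_trans ?_ (dimH_mono (codedLimitSet_subset_conical hρ (fun j => (hF _ (hk j)).1) hcon))
  refine le_dimH_codedLimitSet hF1 (isCompact_closedBall x₀ ρ)
    (Metric.nonempty_closedBall.2 hρ.le) (fun j => (hcon j).mapsTo hρ)
    (fun j => continuousOn_realMobius fun x hx => (hcon j).realDenom_ne_zero hx) ?_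
    (inv_pos.2 hP) ?_ hs ?_
  · intro i j hij
    refine hdisj (hk i) (hk j) fun h => hij ?_
    exact F.equivFin.symm.injective (Subtype.ext h)
  · intro j x hx y hy
    have hx0 := (hcon j).realDenom_ne_zero hx
    have hy0 := (hcon j).realDenom_ne_zero hy
    have h1 := (hF _ (hk j)).2.2 x hx
    have h2 := (hF _ (hk j)).2.2 y hy
    rw [Real.dist_eq (realMobius _ x), realMobius_sub _ hx0 hy0, abs_div, abs_mul,
      Real.dist_eq, div_eq_inv_mul]
    gcongr
    nlinarith [sq_nonneg (|realDenom (k j) x| - |realDenom (k j) y|)]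
  · rwa [Real.inv_rpow hP.le, ← div_eq_mul_inv, one_le_div (by positivity)]

end ConicalLimitSet

/-- **Bishop–Jones.** For a non-elementary discrete purely hyperbolic subgroup `Γ` of
`SL(2, ℝ)`, the Hausdorff dimension of the conical limit set equals the critical exponent
`δ(Γ)`, the infimum of the set of `s > 0` for which the Poincaré series
`Σ_{γ ∈ Γ} exp(−s · d(i, γ·i))` converges. -/
theorem dimH_conical_eq_criticalExponent
    (Γ : Subgroup SL(2, ℝ)) (hdisc : DiscreteTopology Γ)
    (hPH : PurelyHyperbolic Γ) (hNE : IsNonElementary Γ) :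
    dimH {x : ℝ | IsConicalLimitPoint Γ (projPt x)} =
      ENNReal.ofReal (sInf {s : ℝ | 0 < s ∧
        Summable fun γ : Γ => Real.exp
          (-s * dist UpperHalfPlane.I ((γ : SL(2, ℝ)) • UpperHalfPlane.I))}) := by
  set E := {x : ℝ | IsConicalLimitPoint Γ (projPt x)}
  set S := {s : ℝ | 0 < s ∧ Summable fun γ : Γ => Real.exp
    (-s * dist UpperHalfPlane.I ((γ : SL(2, ℝ)) • UpperHalfPlane.I))}
  have hbdd : BddBelow S := ⟨0, fun s hs => hs.1.le⟩
  have hlower : ∀ s t : ℝ, 0 < s → s < t → t ∉ S → ENNReal.ofReal s ≤ dimH E :=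
    fun s t hs hst ht => le_dimH_conical hdisc hPH hNE hs hst fun h => ht ⟨hs.trans hst, h⟩
  have hne : S.Nonempty := by
    by_contra! hS
    have h1 := (hlower 2 3 two_pos (by norm_num) (by simp [hS])).trans
      ((dimH_mono (Set.subset_univ E)).trans_eq Real.dimH_univ)
    norm_num at h1
  apply le_antisymm
  · have h1 : ∀ s ∈ S, dimH E ≤ ENNReal.ofReal s := fun s hs => dimH_conical_le hs.1 hs.2
    have htop : dimH E ≠ ⊤ := ((h1 _ hne.some_mem).trans_lt ENNReal.ofReal_lt_top).ne
    rw [← ENNReal.ofReal_toReal htop]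
    refine ENNReal.ofReal_le_ofReal (le_csInf hne fun s hs => ?_)
    exact ENNReal.toReal_le_of_le_ofReal hs.1.le (h1 s hs)
  · refine le_of_forall_lt fun c hc => ?_
    have hc' : c ≠ ⊤ := (hc.trans ENNReal.ofReal_lt_top).ne
    rw [← ENNReal.ofReal_toReal hc', ENNReal.ofReal_lt_ofReal_iff_of_nonneg
      ENNReal.toReal_nonneg] at hc
    obtain ⟨s, hcs, hs⟩ := exists_between hc
    obtain ⟨t, hst, ht⟩ := exists_between hs
    have hs0 : 0 < s := ENNReal.toReal_nonneg.trans_lt hcs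
    refine lt_of_lt_of_le ?_ (hlower s t hs0 hst (notMem_of_lt_csInf ht hbdd))
    rwa [← ENNReal.ofReal_toReal hc', ENNReal.ofReal_lt_ofReal_iff hs0]

end
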